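/- Let G = (V, E) be a finite simple graph and let w : E → ℝ be injective on the edge set with w(e) ≥ 0 for all e ∈ E. For each vertex v with at least one incident edge, let f(v) be the edge incident to v of maximum weight, and let F = { f(v) : v ∈ V, v not isolated }. Then for every acyclic set of edges T ⊆ E (i.e., every forest of G), it holds that Σ_{e∈T} w(e) ≤ 2·Σ_{e∈F} w(e) and |T| ≤ 2·|F|. In particular, F has at least half the weight and at least half the number of edges of a maximum-weight spanning forest. -/

import Mathlib

/-- In an acyclic graph, one can choose a parent for each vertex such that every edge joins
a vertex to its parent. -/
theorem acyclic_exists_parent {V : Type*} (H : SimpleGraph V) (hH : H.IsAcyclic) :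
    ∃ par : V → V, ∀ e ∈ H.edgeSet, ∃ x : V, e = s(par x, x) := by
  classical
  have hr : ∀ v : V, H.Reachable (H.connectedComponentMk v).out v := fun v =>
    SimpleGraph.ConnectedComponent.exact (Quot.out_eq _)
  choose p hp using fun v => (hr v).exists_isPath
  refine ⟨fun v => (p v).penultimate, ?_⟩
  intro e
  induction e with
  | _ u v =>
  intro huv
  have huv : H.Adj u v := huv
  have hc : H.connectedComponentMk u = H.connectedComponentMk v :=
    SimpleGraph.ConnectedComponent.sound huv.reachable
  obtain ⟨q, hq⟩ : ∃ q : H.Walk (H.connectedComponentMk v).out u,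
      q.IsPath ∧ q.penultimate = (p u).penultimate := by
    have := hp u
    generalize p u = pu at this
    revert pu
    rw [hc]
    intro pu h
    exact ⟨pu, h, rfl⟩
  by_cases hu : u ∈ (p v).support
  · exact ⟨v, by beta_reduce; rw [← hH.eq_penultimate_of_adj_end (hp v) huv.symm hu]⟩
  · have hv : v ∈ q.support :=
      hH.mem_support_of_ne_mem_support_of_adj_of_isPath hq.1 (hp v) huv hu
    refine ⟨u, ?_⟩
    beta_reduce
    rw [← hq.2, ← hH.eq_penultimate_of_adj_end hq.1 huv hv, Sym2.eq_swap]

/-- If each non-isolated vertex `v` of a finite simple graph with pairwise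
distinct nonnegative edge weights selects its maximum-weight incident edge
`f v`, then the set `F` of selected edges has at least half the weight and at
least half the number of edges of every forest `T` of the graph. -/
theorem max_incident_edges_half_approx {V : Type*} [Fintype V] (G : SimpleGraph V)
    (w : Sym2 V → ℝ) (hw : Set.InjOn w G.edgeSet)
    (hw0 : ∀ e ∈ G.edgeSet, 0 ≤ w e)
    (f : V → Sym2 V)
    (hf : ∀ v : V, (G.incidenceSet v).Nonempty →
      f v ∈ G.incidenceSet v ∧ ∀ e ∈ G.incidenceSet v, w e ≤ w (f v))
    (F : Set (Sym2 V))
    (hF : F = {e : Sym2 V | ∃ v : V, (G.incidenceSet v).Nonempty ∧ e = f v})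
    (T : Set (Sym2 V)) (hTE : T ⊆ G.edgeSet)
    (hT : (SimpleGraph.fromEdgeSet T).IsAcyclic) :
    (∑ᶠ e ∈ T, w e ≤ 2 * ∑ᶠ e ∈ F, w e) ∧ T.ncard ≤ 2 * F.ncard := by
  classical
  obtain ⟨par, hpar⟩ := acyclic_exists_parent _ hT
  have hpar' : ∀ e : Sym2 V, ∃ x : V, e ∈ T → e = s(par x, x) := by
    intro e
    by_cases he : e ∈ T
    · obtain ⟨x, hx⟩ := hpar e (by
        rw [SimpleGraph.edgeSet_fromEdgeSet]
        exact ⟨he, G.not_isDiag_of_mem_edgeSet (hTE he)⟩)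
      exact ⟨x, fun _ => hx⟩
    · exact ⟨e.out.1, fun h => absurd h he⟩
  choose c hc using hpar'
  have hinc : ∀ e ∈ T, e ∈ G.incidenceSet (c e) := fun e he =>
    ⟨hTE he, by
      have h : c e ∈ s(par (c e), c e) := Sym2.mem_mk_right _ _
      rwa [← hc e he] at h⟩
  have hFE : ∀ e ∈ F, e ∈ G.edgeSet := by
    rw [hF]
    rintro e ⟨v, hv, rfl⟩
    exact (hf v hv).1.1
  have hmaps : ∀ e ∈ T.toFinset, f (c e) ∈ F.toFinset := by
    intro e he
    rw [Set.mem_toFinset] at he ⊢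
    rw [hF]
    exact ⟨c e, ⟨e, hinc e he⟩, rfl⟩
  have hfib : ∀ g ∈ F.toFinset, (T.toFinset.filter (fun e => f (c e) = g)).card ≤ 2 := by
    intro g _
    induction g with
    | _ a b =>
    calc _ ≤ ({a, b} : Finset V).card := by
          apply Finset.card_le_card_of_injOn c
          · intro e he
            simp only [Finset.coe_filter, Set.mem_toFinset, Set.mem_ofPred_eq] at he
            have h := (hf (c e) ⟨e, hinc e he.1⟩).1.2
            rw [he.2] at h
            simpa using h
          · intro e he e' he' h
            simp only [Finset.coe_filter, Set.mem_toFinset, Set.mem_ofPred_eq] at he he'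
            rw [hc e he.1, hc e' he'.1, h]
      _ ≤ 2 := Finset.card_le_two
  constructor
  · rw [finsum_mem_eq_toFinset_sum, finsum_mem_eq_toFinset_sum]
    calc ∑ e ∈ T.toFinset, w e ≤ ∑ e ∈ T.toFinset, w (f (c e)) := by
          apply Finset.sum_le_sum
          intro e he
          rw [Set.mem_toFinset] at he
          exact (hf (c e) ⟨e, hinc e he⟩).2 e (hinc e he)
      _ = ∑ g ∈ F.toFinset, ∑ e ∈ T.toFinset.filter (fun e => f (c e) = g), w (f (c e)) :=
          (Finset.sum_fiberwise_of_maps_to hmaps _).symm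
      _ ≤ ∑ g ∈ F.toFinset, 2 * w g := by
          apply Finset.sum_le_sum
          intro g hg
          rw [Finset.sum_congr rfl (g := fun _ => w g)
            (fun e he => by rw [(Finset.mem_filter.1 he).2]), Finset.sum_const, nsmul_eq_mul]
          exact mul_le_mul_of_nonneg_right (by exact_mod_cast hfib g hg)
            (hw0 g (hFE g (Set.mem_toFinset.1 hg)))
      _ = 2 * ∑ g ∈ F.toFinset, w g := by rw [Finset.mul_sum]
  · rw [Set.ncard_eq_toFinset_card', Set.ncard_eq_toFinset_card']
    exact Finset.card_le_mul_card_image_of_maps_to hmaps 2 hfib
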